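/- arXiv:1810.04552 — 9 statements merged into one kernel-verified Lean document; each statement's English description precedes it below -/
import Mathlib

section
/- Let L be a finite distributive lattice over a field K, let (C, f) be an L-filtered chain complex, and let (C', π) be a strict J(L)-graded chain complex, where J(L) denotes the set of join-irreducible elements of L with the partial order inherited from L. For a ∈ L and n ∈ ℤ define f'_n(a) := ∑_{q ∈ J(L), q ≤ a} range(π^q_n) ⊆ C'_n. Then (C', f') is an L-filtered chain complex, and if (C, f) and (C', f') are L-filtered chain homotopy equivalent, then for every j ∈ ℤ and all a ≤ b in L the persistent homology groups PH_j^{a,b}(C, f) and PH_j^{a,b}(C', f') are isomorphic as K-vector spaces. -/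
/-- An element of a lattice with bottom is join-irreducible if it is nonzero
and is not a nontrivial join. -/
def JoinIrred {L : Type*} [Lattice L] [OrderBot L] (a : L) : Prop :=
  a ≠ ⊥ ∧ ∀ b c : L, a = b ⊔ c → a = b ∨ a = c

/-- A family of projections giving a `P`-grading of a vector space `V`. -/
def IsGrading {K : Type*} [Field K] {P : Type*} [Fintype P]
    {V : Type*} [AddCommGroup V] [Module K V] (π : P → V →ₗ[K] V) : Prop :=
  (∀ p, π p ∘ₗ π p = π p) ∧ (∑ p, π p) = LinearMap.id ∧
    (∀ p q, p ≠ q → π p ∘ₗ π q = 0)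

/-- A linear map between `P`-graded vector spaces is `P`-filtered if its
`(p,q)`-component is nonzero only when `p ≤ q`. -/
def IsFilteredMap {K : Type*} [Field K] {P : Type*} [PartialOrder P]
    {V W : Type*} [AddCommGroup V] [Module K V] [AddCommGroup W] [Module K W]
    (πV : P → V →ₗ[K] V) (πW : P → W →ₗ[K] W) (φ : V →ₗ[K] W) : Prop :=
  ∀ p q : P, πW p ∘ₗ φ ∘ₗ πV q ≠ 0 → p ≤ q

/-- The `L`-filtering induced on a `J(L)`-graded vector space:
`f'_n(a) = ∑_{q ∈ J(L), q ≤ a} range (π^q_n)`. -/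
def gradedFilt {K : Type*} [Field K] {L : Type*} [DistribLattice L] [BoundedOrder L]
    {C' : ℤ → Type*} [∀ n, AddCommGroup (C' n)] [∀ n, Module K (C' n)]
    (π : ∀ n : ℤ, {q : L // JoinIrred q} → C' n →ₗ[K] C' n)
    (n : ℤ) (a : L) : Submodule K (C' n) :=
  ⨆ q : {q : L // JoinIrred q}, ⨆ _ : (q : L) ≤ a, LinearMap.range (π n q)

/-- The cycles of an `L`-filtered chain complex in degree `n + 1` lying in the
filtration piece of `a`. -/
abbrev filtCycles {K : Type*} [Field K] {L : Type*}
    {C : ℤ → Type*} [∀ n, AddCommGroup (C n)] [∀ n, Module K (C n)]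
    (d : ∀ n : ℤ, C (n + 1) →ₗ[K] C n) (f : ∀ n : ℤ, L → Submodule K (C n))
    (n : ℤ) (a : L) : Submodule K (C (n + 1)) :=
  f (n + 1) a ⊓ LinearMap.ker (d n)

/-- The persistent homology group `PH^{a,b}` in degree `n + 1`: the image of
`H(f(a)) → H(f(b))`, realized as the cycles in `f(a)` modulo those that bound
in `f(b)`. -/
abbrev PH {K : Type*} [Field K] {L : Type*}
    {C : ℤ → Type*} [∀ n, AddCommGroup (C n)] [∀ n, Module K (C n)]
    (d : ∀ n : ℤ, C (n + 1) →ₗ[K] C n) (f : ∀ n : ℤ, L → Submodule K (C n))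
    (n : ℤ) (a b : L) : Type _ :=
  ↥(filtCycles d f n a) ⧸
    Submodule.comap (filtCycles d f n a).subtype
      (Submodule.map (d (n + 1)) (f (n + 1 + 1) b))

/-- A join-irreducible element of a distributive lattice is join-prime. -/
theorem JoinIrred.le_sup_iff {L : Type*} [DistribLattice L] [OrderBot L] {q : L}
    (hq : JoinIrred q) (a b : L) : q ≤ a ⊔ b ↔ q ≤ a ∨ q ≤ b := by
  refine ⟨fun h => ?_, fun h => h.elim le_sup_of_le_left le_sup_of_le_right⟩
  have hsplit : q = q ⊓ a ⊔ q ⊓ b := by rw [← inf_sup_left, inf_eq_left.2 h]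
  exact (hq.2 _ _ hsplit).imp (fun h => inf_eq_left.1 h.symm) (fun h => inf_eq_left.1 h.symm)

/-- Every vector is the sum of its components in a grading. -/
theorem IsGrading.sum_apply {K : Type*} [Field K] {P : Type*} [Fintype P]
    {V : Type*} [AddCommGroup V] [Module K V] {π : P → V →ₗ[K] V} (hπ : IsGrading π) (x : V) :
    ∑ p, π p x = x := by
  simpa using LinearMap.congr_fun hπ.2.1 x

section GradedFilt

variable {K : Type*} [Field K] {L : Type*} [DistribLattice L] [BoundedOrder L]
  {C : ℤ → Type*} [∀ n, AddCommGroup (C n)] [∀ n, Module K (C n)]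
  {π : ∀ n : ℤ, {q : L // JoinIrred q} → C n →ₗ[K] C n}

/-- Membership in the induced filtering is the vanishing of the components outside the down-set. -/
theorem mem_gradedFilt_iff [Fintype {q : L // JoinIrred q}] {n : ℤ} (hπ : IsGrading (π n))
    (a : L) (x : C n) :
    x ∈ gradedFilt π n a ↔ ∀ q : {q : L // JoinIrred q}, ¬ (q : L) ≤ a → π n q x = 0 := by
  constructor
  · intro hx q hq
    have hle : gradedFilt π n a ≤ LinearMap.ker (π n q) := by
      refine iSup₂_le fun p hp => ?_
      rintro _ ⟨y, rfl⟩
      have hne : q ≠ p := fun h => hq (h ▸ hp)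
      exact LinearMap.congr_fun (hπ.2.2 q p hne) y
    exact hle hx
  · intro h
    rw [← hπ.sum_apply x]
    refine Submodule.sum_mem _ fun q _ => ?_
    by_cases hq : (q : L) ≤ a
    · exact le_iSup₂_of_le (f := fun (p : {q : L // JoinIrred q}) (_ : (p : L) ≤ a) =>
        LinearMap.range (π n p)) q hq le_rfl ⟨x, rfl⟩
    · rw [h q hq]
      exact Submodule.zero_mem _

theorem gradedFilt_bot (n : ℤ) : gradedFilt π n (⊥ : L) = ⊥ :=
  le_bot_iff.1 (iSup₂_le fun q hq => absurd (le_bot_iff.1 hq) q.2.1)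

theorem gradedFilt_top [Fintype {q : L // JoinIrred q}] {n : ℤ} (hπ : IsGrading (π n)) :
    gradedFilt π n (⊤ : L) = ⊤ :=
  eq_top_iff.2 fun x _ => (mem_gradedFilt_iff hπ ⊤ x).2 fun _ hq => absurd le_top hq

theorem gradedFilt_sup (n : ℤ) (a b : L) :
    gradedFilt π n (a ⊔ b) = gradedFilt π n a ⊔ gradedFilt π n b := by
  simp only [gradedFilt, ← iSup_sup_eq]
  refine iSup_congr fun q => ?_
  exact (iSup_congr_Prop (q.2.le_sup_iff a b) fun _ => rfl).trans iSup_or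

theorem gradedFilt_inf [Fintype {q : L // JoinIrred q}] {n : ℤ} (hπ : IsGrading (π n)) (a b : L) :
    gradedFilt π n (a ⊓ b) = gradedFilt π n a ⊓ gradedFilt π n b := by
  ext x
  simp only [Submodule.mem_inf, mem_gradedFilt_iff hπ, le_inf_iff, not_and_or, or_imp, forall_and]

/-- A `J(L)`-filtered boundary map preserves the induced filtering. -/
theorem map_gradedFilt_le [Fintype {q : L // JoinIrred q}] (hπ : ∀ n, IsGrading (π n)) {m n : ℤ}
    {g : C m →ₗ[K] C n} (hg : IsFilteredMap (π m) (π n) g) (a : L) :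
    Submodule.map g (gradedFilt π m a) ≤ gradedFilt π n a := by
  rintro _ ⟨x, hx, rfl⟩
  refine (mem_gradedFilt_iff (hπ n) a _).2 fun p hp => ?_
  rw [← (hπ m).sum_apply x, map_sum, map_sum]
  refine Finset.sum_eq_zero fun q _ => ?_
  by_cases hq : (q : L) ≤ a
  · have hzero : π n p ∘ₗ g ∘ₗ π m q = 0 := by
      by_contra hne
      exact hp (le_trans (hg p q hne) hq)
    exact LinearMap.congr_fun hzero x
  · rw [(mem_gradedFilt_iff (hπ m) a x).1 hx q hq, map_zero, map_zero]

end GradedFilt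

section PersistentHomology

variable {K : Type*} [Field K] {L : Type*}
  {C D : ℤ → Type*} [∀ n, AddCommGroup (C n)] [∀ n, Module K (C n)]
  [∀ n, AddCommGroup (D n)] [∀ n, Module K (D n)]
  {d : ∀ n : ℤ, C (n + 1) →ₗ[K] C n} {f : ∀ n : ℤ, L → Submodule K (C n)}
  {d' : ∀ n : ℤ, D (n + 1) →ₗ[K] D n} {f' : ∀ n : ℤ, L → Submodule K (D n)}

/-- A filtered chain map sends filtered cycles to filtered cycles. -/
theorem mem_filtCycles_of_chainMap {φ : ∀ n, C n →ₗ[K] D n}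
    (hφ : ∀ (n : ℤ) (a : L), Submodule.map (φ n) (f n a) ≤ f' n a)
    (hcomm : ∀ (n : ℤ) (x : C (n + 1)), φ n (d n x) = d' n (φ (n + 1) x)) (n : ℤ) (a : L) :
    ∀ x ∈ filtCycles d f n a, φ (n + 1) x ∈ filtCycles d' f' n a := by
  rintro x ⟨hx, hdx⟩
  refine ⟨hφ _ _ ⟨x, hx, rfl⟩, ?_⟩
  exact LinearMap.mem_ker.2 (by rw [← hcomm, LinearMap.mem_ker.1 hdx, map_zero])

/-- The map induced on persistent homology by a filtered chain map. -/
noncomputable def persistentHomologyMap (φ : ∀ n, C n →ₗ[K] D n)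
    (hφ : ∀ (n : ℤ) (a : L), Submodule.map (φ n) (f n a) ≤ f' n a)
    (hcomm : ∀ (n : ℤ) (x : C (n + 1)), φ n (d n x) = d' n (φ (n + 1) x)) (n : ℤ) (a b : L) :
    PH d f n a b →ₗ[K] PH d' f' n a b :=
  Submodule.mapQ _ _ ((φ (n + 1)).restrict (mem_filtCycles_of_chainMap hφ hcomm n a)) (by
    rintro x ⟨y, hy, hyx⟩
    exact ⟨φ (n + 1 + 1) y, hφ _ _ ⟨y, hy, rfl⟩, by rw [← hcomm, hyx]; rfl⟩)

/-- Filtered chain maps whose composite is filtered homotopic to the identity induce maps on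
persistent homology whose composite is the identity. -/
theorem persistentHomologyMap_comp_eq_id
    {φ : ∀ n, C n →ₗ[K] D n} {ψ : ∀ n, D n →ₗ[K] C n} {γ : ∀ n : ℤ, C n →ₗ[K] C (n + 1)}
    (hφ : ∀ (n : ℤ) (a : L), Submodule.map (φ n) (f n a) ≤ f' n a)
    (hφd : ∀ (n : ℤ) (x : C (n + 1)), φ n (d n x) = d' n (φ (n + 1) x))
    (hψ : ∀ (n : ℤ) (a : L), Submodule.map (ψ n) (f' n a) ≤ f n a)
    (hψd : ∀ (n : ℤ) (x : D (n + 1)), ψ n (d' n x) = d n (ψ (n + 1) x))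
    (hγ : ∀ (n : ℤ) (a : L), Submodule.map (γ n) (f n a) ≤ f (n + 1) a)
    (hhom : ∀ (n : ℤ) (x : C (n + 1)),
      ψ (n + 1) (φ (n + 1) x) - x = γ n (d n x) + d (n + 1) (γ (n + 1) x))
    (n : ℤ) {a b : L} (hab : f (n + 1 + 1) a ≤ f (n + 1 + 1) b) :
    persistentHomologyMap ψ hψ hψd n a b ∘ₗ persistentHomologyMap φ hφ hφd n a b =
      LinearMap.id := by
  refine Submodule.linearMap_qext _ (LinearMap.ext fun x => ?_)
  refine (Submodule.Quotient.eq _).2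
    ⟨γ (n + 1) x, hab (hγ _ _ ⟨x, x.2.1, rfl⟩), ?_⟩
  have hx := hhom n x
  rw [LinearMap.mem_ker.1 x.2.2, map_zero, zero_add] at hx
  exact hx.symm

end PersistentHomology

/-- Given an L-filtered chain complex (C, f) and a strict
J(L)-graded chain complex (C', π'), the down-set sums
f'_n(a) = ∑_{q ∈ J(L), q ≤ a} range (π'^q_n) make (C', f') an L-filtered chain
complex; and if (C, f) and (C', f') are L-filtered chain homotopy equivalent,
then all their persistent homology groups are isomorphic. -/
theorem stmt_0 {K : Type*} [Field K]
    {L : Type*} [DistribLattice L] [BoundedOrder L] [Fintype L]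
    [DecidablePred fun a : L => JoinIrred a]
    {C C' : ℤ → Type*}
    [∀ n, AddCommGroup (C n)] [∀ n, Module K (C n)]
    [∀ n, AddCommGroup (C' n)] [∀ n, Module K (C' n)]
    -- (C, f) is an L-filtered chain complex
    (d : ∀ n : ℤ, C (n + 1) →ₗ[K] C n)
    (hdd : ∀ (n : ℤ) (x : C (n + 1 + 1)), d n (d (n + 1) x) = 0)
    (f : ∀ n : ℤ, L → Submodule K (C n))
    (hbot : ∀ n, f n ⊥ = ⊥) (htop : ∀ n, f n ⊤ = ⊤)
    (hsup : ∀ n (a b : L), f n (a ⊔ b) = f n a ⊔ f n b)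
    (hinf : ∀ n (a b : L), f n (a ⊓ b) = f n a ⊓ f n b)
    (hd : ∀ (n : ℤ) (a : L), Submodule.map (d n) (f (n + 1) a) ≤ f n a)
    -- (C', π') is a strict J(L)-graded chain complex
    (π' : ∀ n : ℤ, {q : L // JoinIrred q} → C' n →ₗ[K] C' n)
    (hgr' : ∀ n, IsGrading (π' n))
    (d' : ∀ n : ℤ, C' (n + 1) →ₗ[K] C' n)
    (hdf' : ∀ n, IsFilteredMap (π' (n + 1)) (π' n) (d' n))
    (hdd' : ∀ (n : ℤ) (x : C' (n + 1 + 1)), d' n (d' (n + 1) x) = 0)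
    (hstrict' : ∀ (n : ℤ) (q : {q : L // JoinIrred q}),
      π' n q ∘ₗ d' n ∘ₗ π' (n + 1) q = 0) :
    -- (C', gradedFilt π') is an L-filtered chain complex
    ((∀ n, gradedFilt π' n (⊥ : L) = ⊥) ∧
     (∀ n, gradedFilt π' n (⊤ : L) = ⊤) ∧
     (∀ n (a b : L), gradedFilt π' n (a ⊔ b) = gradedFilt π' n a ⊔ gradedFilt π' n b) ∧
     (∀ n (a b : L), gradedFilt π' n (a ⊓ b) = gradedFilt π' n a ⊓ gradedFilt π' n b) ∧
     (∀ (n : ℤ) (a : L),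
        Submodule.map (d' n) (gradedFilt π' (n + 1) a) ≤ gradedFilt π' n a)) ∧
    -- if (C, f) and (C', gradedFilt π') are L-filtered chain homotopy
    -- equivalent, their persistent homology groups are isomorphic
    ((∃ (φ : ∀ n, C n →ₗ[K] C' n) (ψ : ∀ n, C' n →ₗ[K] C n)
        (γ : ∀ n : ℤ, C n →ₗ[K] C (n + 1)) (γ' : ∀ n : ℤ, C' n →ₗ[K] C' (n + 1)),
        (∀ (n : ℤ) (a : L), Submodule.map (φ n) (f n a) ≤ gradedFilt π' n a) ∧
        (∀ (n : ℤ) (a : L), Submodule.map (ψ n) (gradedFilt π' n a) ≤ f n a) ∧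
        (∀ (n : ℤ) (x : C (n + 1)), φ n (d n x) = d' n (φ (n + 1) x)) ∧
        (∀ (n : ℤ) (x : C' (n + 1)), ψ n (d' n x) = d n (ψ (n + 1) x)) ∧
        (∀ (n : ℤ) (a : L), Submodule.map (γ n) (f n a) ≤ f (n + 1) a) ∧
        (∀ (n : ℤ) (a : L),
          Submodule.map (γ' n) (gradedFilt π' n a) ≤ gradedFilt π' (n + 1) a) ∧
        (∀ (n : ℤ) (x : C (n + 1)),
          ψ (n + 1) (φ (n + 1) x) - x = γ n (d n x) + d (n + 1) (γ (n + 1) x)) ∧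
        (∀ (n : ℤ) (x : C' (n + 1)),
          φ (n + 1) (ψ (n + 1) x) - x = γ' n (d' n x) + d' (n + 1) (γ' (n + 1) x))) →
      ∀ (n : ℤ) (a b : L), a ≤ b →
        Nonempty (PH d f n a b ≃ₗ[K] PH d' (gradedFilt π') n a b)) := by
  have hsup' : ∀ n (a b : L),
      gradedFilt π' n (a ⊔ b) = gradedFilt π' n a ⊔ gradedFilt π' n b := gradedFilt_sup
  refine ⟨⟨gradedFilt_bot, fun n => gradedFilt_top (hgr' n), hsup',
    fun n => gradedFilt_inf (hgr' n), fun n => map_gradedFilt_le hgr' (hdf' n)⟩, ?_⟩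
  rintro ⟨φ, ψ, γ, γ', hφ, hψ, hφd, hψd, hγ, hγ', hhom, hhom'⟩ n a b hab
  have hle : f (n + 1 + 1) a ≤ f (n + 1 + 1) b := by
    rw [← sup_eq_right.2 hab, hsup]
    exact le_sup_left
  have hle' : gradedFilt π' (n + 1 + 1) a ≤ gradedFilt π' (n + 1 + 1) b := by
    rw [← sup_eq_right.2 hab, hsup']
    exact le_sup_left
  exact ⟨LinearEquiv.ofLinearMap (persistentHomologyMap φ hφ hφd n a b)
    (persistentHomologyMap ψ hψ hψd n a b)
    (persistentHomologyMap_comp_eq_id hψ hψd hφ hφd hγ' hhom' n hle')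
    (persistentHomologyMap_comp_eq_id hφ hφd hψ hψd hγ hhom n hle)⟩
end

section
/- Let L be a finite distributive lattice and K a field. If φ : (C, f) → (C', f') is an L-filtered chain equivalence between L-filtered chain complexes, then for every j ∈ ℤ and all a ≤ b in L, the map induced by φ on persistent homology, sending the class [x] ∈ PH_j^{a,b}(C, f) to [φ_j(x)] ∈ PH_j^{a,b}(C', f'), is a well-defined linear isomorphism. -/
section PersistentHomologyMap

variable {K : Type*} [Field K] {L : Type*} {C : ℤ → Type*} {C' : ℤ → Type*}
  [∀ n, AddCommGroup (C n)] [∀ n, Module K (C n)]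
  [∀ n, AddCommGroup (C' n)] [∀ n, Module K (C' n)]
  {d : ∀ n : ℤ, C (n + 1) →ₗ[K] C n} {d' : ∀ n : ℤ, C' (n + 1) →ₗ[K] C' n}
  {f : ∀ n : ℤ, L → Submodule K (C n)} {f' : ∀ n : ℤ, L → Submodule K (C' n)}

/-- A filtered chain map restricts to the cycles of each filtration piece. -/
def filtCyclesMap (φ : ∀ n, C n →ₗ[K] C' n)
    (hφf : ∀ (n : ℤ) (a : L), Submodule.map (φ n) (f n a) ≤ f' n a)
    (hφc : ∀ (n : ℤ) (x : C (n + 1)), φ n (d n x) = d' n (φ (n + 1) x))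
    (n : ℤ) (a : L) : filtCycles d f n a →ₗ[K] filtCycles d' f' n a :=
  (φ (n + 1)).restrict fun x hx =>
    ⟨hφf _ _ (Submodule.mem_map_of_mem hx.1), by
      rw [SetLike.mem_coe, LinearMap.mem_ker, ← hφc, LinearMap.mem_ker.mp hx.2, map_zero]⟩

/-- The map induced by a filtered chain map on persistent homology. -/
def PHMap (φ : ∀ n, C n →ₗ[K] C' n)
    (hφf : ∀ (n : ℤ) (a : L), Submodule.map (φ n) (f n a) ≤ f' n a)
    (hφc : ∀ (n : ℤ) (x : C (n + 1)), φ n (d n x) = d' n (φ (n + 1) x))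
    (n : ℤ) (a b : L) : PH d f n a b →ₗ[K] PH d' f' n a b :=
  Submodule.mapQ _ _ (filtCyclesMap φ hφf hφc n a) <| by
    rintro x ⟨z, hz, hzx⟩
    exact ⟨φ _ z, hφf _ _ (Submodule.mem_map_of_mem hz),
      (hφc _ _).symm.trans (congrArg (φ (n + 1)) hzx)⟩

/-- If `ψ ∘ φ` is filtered chain homotopic to the identity, then the map induced by `ψ` is a left
inverse of the map induced by `φ`. -/
theorem leftInverse_PHMap {φ : ∀ n, C n →ₗ[K] C' n} {ψ : ∀ n, C' n →ₗ[K] C n}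
    (hφf : ∀ (n : ℤ) (a : L), Submodule.map (φ n) (f n a) ≤ f' n a)
    (hψf : ∀ (n : ℤ) (a : L), Submodule.map (ψ n) (f' n a) ≤ f n a)
    (hφc : ∀ (n : ℤ) (x : C (n + 1)), φ n (d n x) = d' n (φ (n + 1) x))
    (hψc : ∀ (n : ℤ) (x : C' (n + 1)), ψ n (d' n x) = d n (ψ (n + 1) x))
    {γ : ∀ n : ℤ, C n →ₗ[K] C (n + 1)}
    (hγf : ∀ (n : ℤ) (a : L), Submodule.map (γ n) (f n a) ≤ f (n + 1) a)
    (hγ : ∀ (n : ℤ) (x : C (n + 1)),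
      ψ (n + 1) (φ (n + 1) x) - x = γ n (d n x) + d (n + 1) (γ (n + 1) x))
    (n : ℤ) {a b : L} (hab : f (n + 1 + 1) a ≤ f (n + 1 + 1) b) :
    Function.LeftInverse (PHMap ψ hψf hψc n a b) (PHMap φ hφf hφc n a b) := by
  intro q
  obtain ⟨x, rfl⟩ := Submodule.Quotient.mk_surjective _ q
  refine (Submodule.Quotient.eq _).mpr
    ⟨γ _ x, hab (hγf _ _ (Submodule.mem_map_of_mem x.2.1)), ?_⟩
  have h := hγ n x
  rw [LinearMap.mem_ker.mp x.2.2, map_zero, zero_add] at h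
  exact h.symm

end PersistentHomologyMap

/-- An L-filtered chain equivalence φ induces, for every degree
and every pair a ≤ b in L, a well-defined linear isomorphism on persistent
homology sending [x] to [φ(x)]. -/
theorem stmt_1 {K : Type*} [Field K]
    {L : Type*} [DistribLattice L] [BoundedOrder L] [Fintype L]
    {C C' : ℤ → Type*}
    [∀ n, AddCommGroup (C n)] [∀ n, Module K (C n)]
    [∀ n, AddCommGroup (C' n)] [∀ n, Module K (C' n)]
    (d : ∀ n : ℤ, C (n + 1) →ₗ[K] C n) (d' : ∀ n : ℤ, C' (n + 1) →ₗ[K] C' n)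
    (hdd : ∀ (n : ℤ) (x : C (n + 1 + 1)), d n (d (n + 1) x) = 0)
    (hdd' : ∀ (n : ℤ) (x : C' (n + 1 + 1)), d' n (d' (n + 1) x) = 0)
    (f : ∀ n : ℤ, L → Submodule K (C n)) (f' : ∀ n : ℤ, L → Submodule K (C' n))
    -- f and f' are L-filterings
    (hbot : ∀ n, f n ⊥ = ⊥) (htop : ∀ n, f n ⊤ = ⊤)
    (hsup : ∀ n (a b : L), f n (a ⊔ b) = f n a ⊔ f n b)
    (hinf : ∀ n (a b : L), f n (a ⊓ b) = f n a ⊓ f n b)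
    (hd : ∀ (n : ℤ) (a : L), Submodule.map (d n) (f (n + 1) a) ≤ f n a)
    (hbot' : ∀ n, f' n ⊥ = ⊥) (htop' : ∀ n, f' n ⊤ = ⊤)
    (hsup' : ∀ n (a b : L), f' n (a ⊔ b) = f' n a ⊔ f' n b)
    (hinf' : ∀ n (a b : L), f' n (a ⊓ b) = f' n a ⊓ f' n b)
    (hd' : ∀ (n : ℤ) (a : L), Submodule.map (d' n) (f' (n + 1) a) ≤ f' n a)
    -- φ is an L-filtered chain equivalence with homotopy inverse ψ
    (φ : ∀ n, C n →ₗ[K] C' n) (ψ : ∀ n, C' n →ₗ[K] C n)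
    (hφf : ∀ (n : ℤ) (a : L), Submodule.map (φ n) (f n a) ≤ f' n a)
    (hψf : ∀ (n : ℤ) (a : L), Submodule.map (ψ n) (f' n a) ≤ f n a)
    (hφc : ∀ (n : ℤ) (x : C (n + 1)), φ n (d n x) = d' n (φ (n + 1) x))
    (hψc : ∀ (n : ℤ) (x : C' (n + 1)), ψ n (d' n x) = d n (ψ (n + 1) x))
    (γ : ∀ n : ℤ, C n →ₗ[K] C (n + 1)) (γ' : ∀ n : ℤ, C' n →ₗ[K] C' (n + 1))
    (hγf : ∀ (n : ℤ) (a : L), Submodule.map (γ n) (f n a) ≤ f (n + 1) a)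
    (hγ'f : ∀ (n : ℤ) (a : L), Submodule.map (γ' n) (f' n a) ≤ f' (n + 1) a)
    (hγ : ∀ (n : ℤ) (x : C (n + 1)),
      ψ (n + 1) (φ (n + 1) x) - x = γ n (d n x) + d (n + 1) (γ (n + 1) x))
    (hγ' : ∀ (n : ℤ) (x : C' (n + 1)),
      φ (n + 1) (ψ (n + 1) x) - x = γ' n (d' n x) + d' (n + 1) (γ' (n + 1) x)) :
    ∀ (n : ℤ) (a b : L), a ≤ b →
      ∃ Φ : PH d f n a b →ₗ[K] PH d' f' n a b,
        Function.Bijective Φ ∧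
        ∀ (x : filtCycles d f n a) (y : filtCycles d' f' n a),
          (y : C' (n + 1)) = φ (n + 1) (x : C (n + 1)) →
          Φ (Submodule.Quotient.mk x) = Submodule.Quotient.mk y := by
  intro n a b hab
  have mono : f (n + 1 + 1) a ≤ f (n + 1 + 1) b :=
    sup_eq_right.mp (by rw [← hsup, sup_eq_right.mpr hab])
  have mono' : f' (n + 1 + 1) a ≤ f' (n + 1 + 1) b :=
    sup_eq_right.mp (by rw [← hsup', sup_eq_right.mpr hab])
  refine ⟨PHMap φ hφf hφc n a b,
    ⟨(leftInverse_PHMap hφf hψf hφc hψc hγf hγ n mono).injective,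
      (leftInverse_PHMap hψf hφf hψc hφc hγ'f hγ' n mono').surjective⟩, ?_⟩
  intro x y hxy
  have hy : filtCyclesMap φ hφf hφc n a x = y := Subtype.ext hxy.symm
  exact congrArg Submodule.Quotient.mk hy
end

section
/- Let P be a finite poset, K a field, and let (C, π) and (C', π) be strict P-graded chain complexes. Suppose φ : (C, π) → (C', π) and ψ : (C', π) → (C, π) are P-filtered chain maps and there exist P-filtered linear maps γ_n : C_n → C_{n+1} and γ'_n : C'_n → C'_{n+1} such that ψ_n ∘ φ_n − id_{C_n} = γ_{n-1} ∘ ∂_n + ∂_{n+1} ∘ γ_n and φ_n ∘ ψ_n − id_{C'_n} = γ'_{n-1} ∘ ∂'_n + ∂'_{n+1} ∘ γ'_n for all n ∈ ℤ. Then every φ_n is a linear isomorphism whose inverse is P-filtered; consequently, two strict P-graded chain complexes are P-filtered chain equivalent if and only if they are P-filtered chain isomorphic. -/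
section Filtered

variable {K : Type*} [Field K] {P : Type*} {U V W : Type*} [AddCommGroup U] [Module K U]
  [AddCommGroup V] [Module K V] [AddCommGroup W] [Module K W]
  {πU : P → U →ₗ[K] U} {πV : P → V →ₗ[K] V} {πW : P → W →ₗ[K] W}

theorem IsGrading.sum_apply_s4 [Fintype P] (h : IsGrading πV) (x : V) : ∑ p, πV p x = x := by
  simpa using LinearMap.congr_fun h.2.1 x

theorem IsGrading.eq_zero_of_components [Fintype P] (hU : IsGrading πU) (hV : IsGrading πV)
    {f : U →ₗ[K] V} (hf : ∀ p q, πV p ∘ₗ f ∘ₗ πU q = 0) : f = 0 := by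
  ext x
  rw [← hU.sum_apply_s4 x, map_sum, LinearMap.zero_apply]
  refine Finset.sum_eq_zero fun q _ => ?_
  rw [← hV.sum_apply_s4 (f _)]
  exact Finset.sum_eq_zero fun p _ => LinearMap.congr_fun (hf p q) x

/-- A nonzero component of a composite passes through some intermediate degree. -/
theorem IsGrading.exists_component_ne_zero [Fintype P] (hV : IsGrading πV)
    {f : V →ₗ[K] W} {g : U →ₗ[K] V} {p q : P} (h : πW p ∘ₗ (f ∘ₗ g) ∘ₗ πU q ≠ 0) :
    ∃ r, πW p ∘ₗ f ∘ₗ πV r ≠ 0 ∧ πV r ∘ₗ g ∘ₗ πU q ≠ 0 := by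
  contrapose! h
  ext x
  simp only [LinearMap.comp_apply, LinearMap.zero_apply]
  rw [← hV.sum_apply_s4 (g _), map_sum, map_sum]
  refine Finset.sum_eq_zero fun r _ => ?_
  by_cases hr : πW p ∘ₗ f ∘ₗ πV r = 0
  · exact LinearMap.congr_fun hr (g (πU q x))
  · have := LinearMap.congr_fun (h r hr) x
    simp only [LinearMap.comp_apply, LinearMap.zero_apply] at this
    rw [this, map_zero, map_zero]

variable [PartialOrder P]

theorem IsFilteredMap.comp [Fintype P] (hV : IsGrading πV) {f : V →ₗ[K] W} {g : U →ₗ[K] V}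
    (hf : IsFilteredMap πV πW f) (hg : IsFilteredMap πU πV g) :
    IsFilteredMap πU πW (f ∘ₗ g) := by
  intro p q h
  obtain ⟨r, h₁, h₂⟩ := hV.exists_component_ne_zero h
  exact (hf p r h₁).trans (hg r q h₂)

/-- The `P`-filtered endomorphisms of a `P`-graded vector space form a ring. -/
def filteredEnd [Fintype P] (hV : IsGrading πV) : Subring (Module.End K V) where
  carrier := {f | IsFilteredMap πV πV f}
  mul_mem' hf hg := IsFilteredMap.comp hV hf hg
  one_mem' p q h := by
    by_contra hpq
    exact h (hV.2.2 p q fun e => hpq e.le)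
  add_mem' {f g} hf hg p q h := by
    by_contra hpq
    refine h ?_
    rw [LinearMap.add_comp, LinearMap.comp_add, not_not.1 (mt (hf p q) hpq),
      not_not.1 (mt (hg p q) hpq), add_zero]
  zero_mem' p q h := by simp at h
  neg_mem' {f} hf p q h := by
    refine hf p q fun h0 => h ?_
    rw [LinearMap.neg_comp, LinearMap.comp_neg, h0, neg_zero]

/-- A linear map whose `(p, q)`-component is nonzero only when `p < q`. -/
def IsStrictlyFilteredMap (πV : P → V →ₗ[K] V) (πW : P → W →ₗ[K] W) (f : V →ₗ[K] W) : Prop :=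
  ∀ p q : P, πW p ∘ₗ f ∘ₗ πV q ≠ 0 → p < q

theorem IsStrictlyFilteredMap.isFilteredMap {f : V →ₗ[K] W}
    (hf : IsStrictlyFilteredMap πV πW f) : IsFilteredMap πV πW f :=
  fun p q h => (hf p q h).le

theorem IsFilteredMap.isStrictlyFilteredMap {f : V →ₗ[K] W} (hf : IsFilteredMap πV πW f)
    (h : ∀ p, πW p ∘ₗ f ∘ₗ πV p = 0) : IsStrictlyFilteredMap πV πW f := by
  refine fun p q hpq => (hf p q hpq).lt_of_ne ?_
  rintro rfl
  exact hpq (h p)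

theorem IsStrictlyFilteredMap.comp_left [Fintype P] (hV : IsGrading πV) {f : V →ₗ[K] W}
    {g : U →ₗ[K] V} (hf : IsFilteredMap πV πW f) (hg : IsStrictlyFilteredMap πU πV g) :
    IsStrictlyFilteredMap πU πW (f ∘ₗ g) := by
  intro p q h
  obtain ⟨r, h₁, h₂⟩ := hV.exists_component_ne_zero h
  exact (hf p r h₁).trans_lt (hg r q h₂)

theorem IsStrictlyFilteredMap.comp_right [Fintype P] (hV : IsGrading πV) {f : V →ₗ[K] W}
    {g : U →ₗ[K] V} (hf : IsStrictlyFilteredMap πV πW f) (hg : IsFilteredMap πU πV g) :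
    IsStrictlyFilteredMap πU πW (f ∘ₗ g) := by
  intro p q h
  obtain ⟨r, h₁, h₂⟩ := hV.exists_component_ne_zero h
  exact (hf p r h₁).trans_le (hg r q h₂)

theorem IsStrictlyFilteredMap.add {f g : V →ₗ[K] W} (hf : IsStrictlyFilteredMap πV πW f)
    (hg : IsStrictlyFilteredMap πV πW g) : IsStrictlyFilteredMap πV πW (f + g) := by
  intro p q h
  by_contra hpq
  refine h ?_
  rw [LinearMap.add_comp, LinearMap.comp_add, not_not.1 (mt (hf p q) hpq),
    not_not.1 (mt (hg p q) hpq), add_zero]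

theorem IsStrictlyFilteredMap.isNilpotent [Fintype P] (hV : IsGrading πV) {f : Module.End K V}
    (hf : IsStrictlyFilteredMap πV πV f) : IsNilpotent f := by
  have hpow (k : ℕ) : ∀ p q : P, πV p ∘ₗ (f ^ k) ∘ₗ πV q ≠ 0 →
      (Set.Iio p).ncard + k ≤ (Set.Iio q).ncard := by
    induction k with
    | zero =>
      intro p q h
      obtain rfl : p = q := by
        by_contra hpq
        exact h (hV.2.2 p q hpq)
      simp
    | succ k ih =>
      intro p q h
      rw [pow_succ] at h
      obtain ⟨r, h₁, h₂⟩ := hV.exists_component_ne_zero h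
      have hlt : (Set.Iio r).ncard < (Set.Iio q).ncard :=
        Set.ncard_lt_ncard (Set.Iio_ssubset_Iio (hf r q h₂)) (Set.toFinite _)
      have := ih p r h₁
      omega
  refine ⟨Nat.card P + 1, hV.eq_zero_of_components hV fun p q => ?_⟩
  by_contra h
  have h₁ := hpow _ p q h
  have h₂ := Set.ncard_le_card (Set.Iio q)
  omega

/-- A unipotent perturbation `1 + f` of the identity has a `P`-filtered inverse. -/
theorem IsStrictlyFilteredMap.exists_inverse_one_add [Fintype P] (hV : IsGrading πV)
    {f : Module.End K V} (hf : IsStrictlyFilteredMap πV πV f) :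
    ∃ g : Module.End K V, IsFilteredMap πV πV g ∧ (1 + f) * g = 1 ∧ g * (1 + f) = 1 := by
  let F : filteredEnd hV := ⟨f, hf.isFilteredMap⟩
  have hF : IsNilpotent F := by
    obtain ⟨k, hk⟩ := hf.isNilpotent hV
    exact ⟨k, Subtype.ext hk⟩
  obtain ⟨u, hu⟩ := hF.isUnit_one_add
  refine ⟨(↑u⁻¹ : filteredEnd hV), (↑u⁻¹ : filteredEnd hV).2, ?_, ?_⟩
  · exact congrArg Subtype.val (hu ▸ u.mul_inv : (1 + F) * ↑u⁻¹ = 1)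
  · exact congrArg Subtype.val (hu ▸ u.inv_mul : ↑u⁻¹ * (1 + F) = 1)

end Filtered

/-- An endomorphism in degree `n + 1` of a strict graded complex that is chain homotopic to the
identity through filtered maps has a filtered inverse. -/
theorem exists_filtered_inverse_of_homotopy {K : Type*} [Field K] {P : Type*} [PartialOrder P]
    [Fintype P] {U V W : Type*} [AddCommGroup U] [Module K U] [AddCommGroup V] [Module K V]
    [AddCommGroup W] [Module K W]
    {πU : P → U →ₗ[K] U} {πV : P → V →ₗ[K] V} {πW : P → W →ₗ[K] W}
    (hU : IsGrading πU) (hV : IsGrading πV) (hW : IsGrading πW)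
    {d₁ : U →ₗ[K] V} {d₀ : V →ₗ[K] W} {γ₁ : V →ₗ[K] U} {γ₀ : W →ₗ[K] V}
    (hd₁ : IsFilteredMap πU πV d₁) (hd₀ : IsFilteredMap πV πW d₀)
    (hs₁ : ∀ p, πV p ∘ₗ d₁ ∘ₗ πU p = 0) (hs₀ : ∀ p, πW p ∘ₗ d₀ ∘ₗ πV p = 0)
    (hγ₁ : IsFilteredMap πV πU γ₁) (hγ₀ : IsFilteredMap πW πV γ₀)
    {e : Module.End K V} (he : ∀ x, e x - x = γ₀ (d₀ x) + d₁ (γ₁ x)) :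
    ∃ g : Module.End K V, IsFilteredMap πV πV g ∧ (∀ x, e (g x) = x) ∧ ∀ x, g (e x) = x := by
  have hN : IsStrictlyFilteredMap πV πV (γ₀ ∘ₗ d₀ + d₁ ∘ₗ γ₁) :=
    (IsStrictlyFilteredMap.comp_left hW hγ₀ (hd₀.isStrictlyFilteredMap hs₀)).add
      ((hd₁.isStrictlyFilteredMap hs₁).comp_right hU hγ₁)
  obtain ⟨g, hg, h₁, h₂⟩ := hN.exists_inverse_one_add hV
  have h : 1 + (γ₀ ∘ₗ d₀ + d₁ ∘ₗ γ₁) = e := by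
    ext x
    simp [← he x]
  rw [h] at h₁ h₂
  exact ⟨g, hg, LinearMap.congr_fun h₁, LinearMap.congr_fun h₂⟩

/-- If two strict P-graded chain complexes are P-filtered chain
homotopy equivalent via φ and ψ, then every φ_n is a linear isomorphism with a
P-filtered inverse; hence strict P-graded chain complexes are P-filtered chain
equivalent iff they are P-filtered chain isomorphic. -/
theorem stmt_4 {K : Type*} [Field K] {P : Type*} [PartialOrder P] [Fintype P]
    {C C' : ℤ → Type*}
    [∀ n, AddCommGroup (C n)] [∀ n, Module K (C n)]
    [∀ n, AddCommGroup (C' n)] [∀ n, Module K (C' n)]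
    (π : ∀ n : ℤ, P → C n →ₗ[K] C n) (π' : ∀ n : ℤ, P → C' n →ₗ[K] C' n)
    (hgr : ∀ n, IsGrading (π n)) (hgr' : ∀ n, IsGrading (π' n))
    (d : ∀ n : ℤ, C (n + 1) →ₗ[K] C n) (d' : ∀ n : ℤ, C' (n + 1) →ₗ[K] C' n)
    (hdf : ∀ n, IsFilteredMap (π (n + 1)) (π n) (d n))
    (hdf' : ∀ n, IsFilteredMap (π' (n + 1)) (π' n) (d' n))
    (hdd : ∀ (n : ℤ) (x : C (n + 1 + 1)), d n (d (n + 1) x) = 0)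
    (hdd' : ∀ (n : ℤ) (x : C' (n + 1 + 1)), d' n (d' (n + 1) x) = 0)
    -- both complexes are strict
    (hstrict : ∀ (n : ℤ) (p : P), π n p ∘ₗ d n ∘ₗ π (n + 1) p = 0)
    (hstrict' : ∀ (n : ℤ) (p : P), π' n p ∘ₗ d' n ∘ₗ π' (n + 1) p = 0)
    -- P-filtered chain maps φ, ψ
    (φ : ∀ n, C n →ₗ[K] C' n) (ψ : ∀ n, C' n →ₗ[K] C n)
    (hφf : ∀ n, IsFilteredMap (π n) (π' n) (φ n))
    (hψf : ∀ n, IsFilteredMap (π' n) (π n) (ψ n))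
    (hφc : ∀ (n : ℤ) (x : C (n + 1)), φ n (d n x) = d' n (φ (n + 1) x))
    (hψc : ∀ (n : ℤ) (x : C' (n + 1)), ψ n (d' n x) = d n (ψ (n + 1) x))
    -- P-filtered chain homotopies from ψ∘φ to id and from φ∘ψ to id
    (γ : ∀ n : ℤ, C n →ₗ[K] C (n + 1)) (γ' : ∀ n : ℤ, C' n →ₗ[K] C' (n + 1))
    (hγf : ∀ n, IsFilteredMap (π n) (π (n + 1)) (γ n))
    (hγ'f : ∀ n, IsFilteredMap (π' n) (π' (n + 1)) (γ' n))
    (hγ : ∀ (n : ℤ) (x : C (n + 1)),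
      ψ (n + 1) (φ (n + 1) x) - x = γ n (d n x) + d (n + 1) (γ (n + 1) x))
    (hγ' : ∀ (n : ℤ) (x : C' (n + 1)),
      φ (n + 1) (ψ (n + 1) x) - x = γ' n (d' n x) + d' (n + 1) (γ' (n + 1) x)) :
    (∀ n, Function.Bijective (φ n)) ∧
      ∃ χ : ∀ n, C' n →ₗ[K] C n,
        (∀ n, IsFilteredMap (π' n) (π n) (χ n)) ∧
        (∀ (n : ℤ) (x : C' (n + 1)), χ n (d' n x) = d n (χ (n + 1) x)) ∧
        (∀ (n : ℤ) (x : C n), χ n (φ n x) = x) ∧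
        (∀ (n : ℤ) (y : C' n), φ n (χ n y) = y) := by
  have hleft : ∀ n, ∃ g : Module.End K (C n), IsFilteredMap (π n) (π n) g ∧
      ∀ x, g (ψ n (φ n x)) = x := by
    intro n
    obtain ⟨m, rfl⟩ : ∃ m, n = m + 1 := ⟨n - 1, by ring⟩
    obtain ⟨g, hg, -, h⟩ := exists_filtered_inverse_of_homotopy (e := ψ (m + 1) ∘ₗ φ (m + 1))
      (hgr _) (hgr _) (hgr _) (hdf (m + 1)) (hdf m) (hstrict (m + 1)) (hstrict m)
      (hγf (m + 1)) (hγf m) (hγ m)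
    exact ⟨g, hg, h⟩
  have hright : ∀ n, ∃ g : Module.End K (C' n), ∀ y, φ n (ψ n (g y)) = y := by
    intro n
    obtain ⟨m, rfl⟩ : ∃ m, n = m + 1 := ⟨n - 1, by ring⟩
    obtain ⟨g, -, h, -⟩ := exists_filtered_inverse_of_homotopy (e := φ (m + 1) ∘ₗ ψ (m + 1))
      (hgr' _) (hgr' _) (hgr' _) (hdf' (m + 1)) (hdf' m) (hstrict' (m + 1)) (hstrict' m)
      (hγ'f (m + 1)) (hγ'f m) (hγ' m)
    exact ⟨g, h⟩
  choose g hgf hg using hleft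
  choose g' hg' using hright
  have hχ : ∀ n y, φ n (g n (ψ n y)) = y := by
    intro n y
    rw [← hg' n y, hg]
  refine ⟨fun n => ⟨(show Function.LeftInverse (g n ∘ₗ ψ n) (φ n) from hg n).injective,
      fun y => ⟨_, hχ n y⟩⟩, fun n => g n ∘ₗ ψ n,
    fun n => (hgf n).comp (hgr n) (hψf n), fun n y => ?_, hg, hχ⟩
  obtain ⟨x, rfl⟩ : ∃ x, φ (n + 1) x = y := ⟨_, hχ _ y⟩
  simp only [LinearMap.comp_apply]
  rw [← hφc, hg, hg]
end

section
/- Let (C, ∂) be a chain complex of K-vector spaces and let γ be a splitting homotopy on C. Define ρ_n := id_{C_n} − (γ_{n-1} ∘ ∂_n + ∂_{n+1} ∘ γ_n). Then: (i) each ρ_n is idempotent and ρ is a chain map C → C; (ii) M_n := range(ρ_n) satisfies ∂_n(M_n) ⊆ M_{n-1}, so M := (M_n) with the restricted differential is a subcomplex of C, and on M the differential equals the restriction of ∂ − ∂∘γ∘∂; (iii) the inclusion i : M → C, the corestriction of ρ to a map C → M, and γ form a reduction from C to M (in particular γ_n ∘ i_n = 0 and ρ_{n+1} ∘ γ_n =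 0 for all n); (iv) the kernels ker(ρ_n) form a subcomplex of C whose homology ker(∂_n|) / image(∂_{n+1}|) vanishes in every degree. -/
/-- The projection `ρ = id − (γ∘∂ + ∂∘γ)` associated to a splitting homotopy,
in degree `n + 1`. -/
def splitProj {K : Type*} [Field K] {C : ℤ → Type*}
    [∀ n, AddCommGroup (C n)] [∀ n, Module K (C n)]
    (d : ∀ n : ℤ, C (n + 1) →ₗ[K] C n) (γ : ∀ n : ℤ, C n →ₗ[K] C (n + 1))
    (n : ℤ) : C (n + 1) →ₗ[K] C (n + 1) :=
  LinearMap.id - (γ n ∘ₗ d n + d (n + 1) ∘ₗ γ (n + 1))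

section SplitProj

variable {K : Type*} [Field K] {C : ℤ → Type*} [∀ n, AddCommGroup (C n)] [∀ n, Module K (C n)]
  {d : ∀ n : ℤ, C (n + 1) →ₗ[K] C n} {γ : ∀ n : ℤ, C n →ₗ[K] C (n + 1)}

theorem splitProj_apply (n : ℤ) (x : C (n + 1)) :
    splitProj d γ n x = x - (γ n (d n x) + d (n + 1) (γ (n + 1) x)) := rfl

theorem splitProj_d (hdd : ∀ (n : ℤ) (x : C (n + 1 + 1)), d n (d (n + 1) x) = 0)
    (n : ℤ) (x : C (n + 1 + 1)) :
    splitProj d γ n (d (n + 1) x) = d (n + 1) (splitProj d γ (n + 1) x) := by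
  simp [splitProj_apply, hdd]

theorem splitProj_γ (hγγ : ∀ (n : ℤ) (x : C n), γ (n + 1) (γ n x) = 0)
    (hγdγ : ∀ (n : ℤ) (x : C n), γ n (d n (γ n x)) = γ n x) (n : ℤ) (x : C n) :
    splitProj d γ n (γ n x) = 0 := by
  simp [splitProj_apply, hγγ, hγdγ]

theorem γ_splitProj (hγγ : ∀ (n : ℤ) (x : C n), γ (n + 1) (γ n x) = 0)
    (hγdγ : ∀ (n : ℤ) (x : C n), γ n (d n (γ n x)) = γ n x) (n : ℤ) (x : C (n + 1)) :
    γ (n + 1) (splitProj d γ n x) = 0 := by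
  simp [splitProj_apply, hγγ, hγdγ]

theorem γ_d_splitProj (hdd : ∀ (n : ℤ) (x : C (n + 1 + 1)), d n (d (n + 1) x) = 0)
    (hγdγ : ∀ (n : ℤ) (x : C n), γ n (d n (γ n x)) = γ n x) (n : ℤ) (x : C (n + 1)) :
    γ n (d n (splitProj d γ n x)) = 0 := by
  simp [splitProj_apply, hdd, hγdγ]

theorem splitProj_splitProj (hdd : ∀ (n : ℤ) (x : C (n + 1 + 1)), d n (d (n + 1) x) = 0)
    (hγγ : ∀ (n : ℤ) (x : C n), γ (n + 1) (γ n x) = 0)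
    (hγdγ : ∀ (n : ℤ) (x : C n), γ n (d n (γ n x)) = γ n x) (n : ℤ) (x : C (n + 1)) :
    splitProj d γ n (splitProj d γ n x) = splitProj d γ n x := by
  rw [splitProj_apply n (splitProj d γ n x), γ_d_splitProj hdd hγdγ, γ_splitProj hγγ hγdγ]
  simp

end SplitProj

/-- Given a splitting homotopy γ on a chain complex (C, ∂), the
map ρ = id − (γ∘∂ + ∂∘γ) is an idempotent chain map; M = range ρ is a
subcomplex whose differential is the restriction of ∂ − ∂∘γ∘∂; the inclusion
of M, the corestriction of ρ, and γ form a reduction (in particular γ vanishes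
on M and ρ∘γ = 0); and the kernels of ρ form a subcomplex with vanishing
homology. -/
theorem stmt_6 {K : Type*} [Field K] {C : ℤ → Type*}
    [∀ n, AddCommGroup (C n)] [∀ n, Module K (C n)]
    (d : ∀ n : ℤ, C (n + 1) →ₗ[K] C n)
    (hdd : ∀ (n : ℤ) (x : C (n + 1 + 1)), d n (d (n + 1) x) = 0)
    (γ : ∀ n : ℤ, C n →ₗ[K] C (n + 1))
    (hγγ : ∀ (n : ℤ) (x : C n), γ (n + 1) (γ n x) = 0)
    (hγdγ : ∀ (n : ℤ) (x : C n), γ n (d n (γ n x)) = γ n x) :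
    -- (i) ρ is idempotent and a chain map
    (∀ n : ℤ, splitProj d γ n ∘ₗ splitProj d γ n = splitProj d γ n) ∧
    (∀ (n : ℤ) (x : C (n + 1 + 1)),
      splitProj d γ n (d (n + 1) x) = d (n + 1) (splitProj d γ (n + 1) x)) ∧
    -- (ii) M = range ρ is a subcomplex, with differential ∂ − ∂∘γ∘∂
    (∀ n : ℤ,
      Submodule.map (d (n + 1)) (LinearMap.range (splitProj d γ (n + 1))) ≤
        LinearMap.range (splitProj d γ n)) ∧
    (∀ (n : ℤ) (x : C (n + 1 + 1)), x ∈ LinearMap.range (splitProj d γ (n + 1)) →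
      d (n + 1) x = d (n + 1) x - d (n + 1) (γ (n + 1) (d (n + 1) x))) ∧
    -- (iii) the inclusion, the corestriction of ρ, and γ form a reduction:
    -- ρ restricts to the identity on M, γ vanishes on M, and ρ∘γ = 0
    (∀ (n : ℤ) (x : C (n + 1)), x ∈ LinearMap.range (splitProj d γ n) →
      splitProj d γ n x = x) ∧
    (∀ (n : ℤ) (x : C (n + 1)), x ∈ LinearMap.range (splitProj d γ n) →
      γ (n + 1) x = 0) ∧
    (∀ (n : ℤ) (x : C n), splitProj d γ n (γ n x) = 0) ∧
    -- (iv) the kernels of ρ form a subcomplex with vanishing homology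
    (∀ n : ℤ,
      Submodule.map (d (n + 1)) (LinearMap.ker (splitProj d γ (n + 1))) ≤
        LinearMap.ker (splitProj d γ n)) ∧
    (∀ (n : ℤ) (x : C (n + 1)), x ∈ LinearMap.ker (splitProj d γ n) →
      d n x = 0 →
      ∃ y : C (n + 1 + 1), y ∈ LinearMap.ker (splitProj d γ (n + 1)) ∧
        d (n + 1) y = x) := by
  refine ⟨fun n => LinearMap.ext (splitProj_splitProj hdd hγγ hγdγ n), splitProj_d hdd,
    ?_, ?_, ?_, ?_, splitProj_γ hγγ hγdγ, ?_, ?_⟩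
  · rintro n _ ⟨_, ⟨x, rfl⟩, rfl⟩
    exact ⟨d (n + 1) x, splitProj_d hdd n x⟩
  · rintro n _ ⟨x, rfl⟩
    rw [γ_d_splitProj hdd hγdγ, map_zero, sub_zero]
  · rintro n _ ⟨x, rfl⟩
    exact splitProj_splitProj hdd hγγ hγdγ n x
  · rintro n _ ⟨x, rfl⟩
    exact γ_splitProj hγγ hγdγ n x
  · rintro n _ ⟨x, hx, rfl⟩
    rw [LinearMap.mem_ker, splitProj_d hdd, LinearMap.mem_ker.mp hx, map_zero]
  · intro n x hx hdx
    refine ⟨γ (n + 1) x, splitProj_γ hγγ hγdγ (n + 1) x, ?_⟩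
    rw [LinearMap.mem_ker, splitProj_apply, hdx, map_zero, zero_add, sub_eq_zero] at hx
    exact hx.symm
end

section
/- Let (ψ, φ, γ) be a reduction from a chain complex (C, ∂) of K-vector spaces to a chain complex (M, ∂^M). Then the reduction is minimal (∂^M_n = 0 for all n) if and only if γ is perfect, i.e., ∂_n ∘ γ_{n-1} ∘ ∂_n = ∂_n for all n ∈ ℤ. -/
/-- A reduction (ψ, φ, γ) from (C, ∂) to (M, ∂^M) is minimal
(∂^M = 0) if and only if γ is perfect (∂ ∘ γ ∘ ∂ = ∂). -/
theorem stmt_7 {K : Type*} [Field K]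
    {C M : ℤ → Type*}
    [∀ n, AddCommGroup (C n)] [∀ n, Module K (C n)]
    [∀ n, AddCommGroup (M n)] [∀ n, Module K (M n)]
    (dC : ∀ n : ℤ, C (n + 1) →ₗ[K] C n) (dM : ∀ n : ℤ, M (n + 1) →ₗ[K] M n)
    (hddC : ∀ (n : ℤ) (x : C (n + 1 + 1)), dC n (dC (n + 1) x) = 0)
    (hddM : ∀ (n : ℤ) (x : M (n + 1 + 1)), dM n (dM (n + 1) x) = 0)
    (ψ : ∀ n, C n →ₗ[K] M n) (φ : ∀ n, M n →ₗ[K] C n)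
    (γ : ∀ n : ℤ, C n →ₗ[K] C (n + 1))
    (hψ : ∀ (n : ℤ) (x : C (n + 1)), ψ n (dC n x) = dM n (ψ (n + 1) x))
    (hφ : ∀ (n : ℤ) (x : M (n + 1)), φ n (dM n x) = dC n (φ (n + 1) x))
    (hψφ : ∀ (n : ℤ) (x : M n), ψ n (φ n x) = x)
    (hφψ : ∀ (n : ℤ) (x : C (n + 1)),
      φ (n + 1) (ψ (n + 1) x) = x - (γ n (dC n x) + dC (n + 1) (γ (n + 1) x)))
    (hγγ : ∀ (n : ℤ) (x : C n), γ (n + 1) (γ n x) = 0)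
    (hγφ : ∀ (n : ℤ) (x : M n), γ n (φ n x) = 0)
    (hψγ : ∀ (n : ℤ) (x : C n), ψ (n + 1) (γ n x) = 0) :
    (∀ n, dM n = 0) ↔ (∀ (n : ℤ) (x : C (n + 1)), dC n (γ n (dC n x)) = dC n x) := by
  have key : ∀ (n : ℤ) (x : C (n + 1)),
      φ n (dM n (ψ (n + 1) x)) = dC n x - dC n (γ n (dC n x)) := by
    intro n x
    rw [hφ, hφψ, map_sub, map_add, hddC, add_zero]
  constructor
  · intro h n x
    have hx := key n x
    rw [h n, LinearMap.zero_apply, map_zero] at hx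
    exact (sub_eq_zero.mp hx.symm).symm
  · intro h n
    ext m
    have hm := key n (φ (n + 1) m)
    rw [h, sub_self, hψφ] at hm
    rw [← hψφ n (dM n m), hm, map_zero, LinearMap.zero_apply]
end

section
/- Let (ψ, φ, γ) be a reduction from a chain complex (C, ∂) of K-vector spaces to (M, ∂^M), and let (ψ', φ', γ') be a reduction from (M, ∂^M) to (M', ∂^{M'}); let γ'' be the composite homotopy defined by γ''_n := γ_n + φ_{n+1} ∘ γ'_n ∘ ψ_n. Then γ'' is a splitting homotopy on (C, ∂) (γ''_{n+1} ∘ γ''_n = 0 and γ''_n ∘ ∂_{n+1} ∘ γ''_n = γ''_n for all n), and if γ is perfect for (C, ∂) or γ' is perfect for (M, ∂^M), then γ'' is perfect for (C, ∂), i.e., ∂_n ∘ γ''_{n-1} ∘ ∂_n = ∂_n for all n (equivalently, the composite reduction from C to M' is minimal). -/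
/-- The composite homotopy `γ'' = γ + φ ∘ γ' ∘ ψ` of two reductions. -/
def compHomotopy {K : Type*} [Field K] {C M : ℤ → Type*}
    [∀ n, AddCommGroup (C n)] [∀ n, Module K (C n)]
    [∀ n, AddCommGroup (M n)] [∀ n, Module K (M n)]
    (ψ : ∀ n, C n →ₗ[K] M n) (φ : ∀ n, M n →ₗ[K] C n)
    (γ : ∀ n : ℤ, C n →ₗ[K] C (n + 1)) (γ' : ∀ n : ℤ, M n →ₗ[K] M (n + 1))
    (n : ℤ) : C n →ₗ[K] C (n + 1) :=
  γ n + φ (n + 1) ∘ₗ γ' n ∘ₗ ψ n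

/-- The composite homotopy γ'' = γ + φ∘γ'∘ψ of two reductions is
a splitting homotopy on (C, ∂), and it is perfect whenever γ or γ' is. -/
theorem stmt_10 {K : Type*} [Field K]
    {C M M' : ℤ → Type*}
    [∀ n, AddCommGroup (C n)] [∀ n, Module K (C n)]
    [∀ n, AddCommGroup (M n)] [∀ n, Module K (M n)]
    [∀ n, AddCommGroup (M' n)] [∀ n, Module K (M' n)]
    (dC : ∀ n : ℤ, C (n + 1) →ₗ[K] C n) (dM : ∀ n : ℤ, M (n + 1) →ₗ[K] M n)
    (dM' : ∀ n : ℤ, M' (n + 1) →ₗ[K] M' n)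
    (hddC : ∀ (n : ℤ) (x : C (n + 1 + 1)), dC n (dC (n + 1) x) = 0)
    (hddM : ∀ (n : ℤ) (x : M (n + 1 + 1)), dM n (dM (n + 1) x) = 0)
    (hddM' : ∀ (n : ℤ) (x : M' (n + 1 + 1)), dM' n (dM' (n + 1) x) = 0)
    -- the first reduction (ψ, φ, γ) from C to M
    (ψ : ∀ n, C n →ₗ[K] M n) (φ : ∀ n, M n →ₗ[K] C n)
    (γ : ∀ n : ℤ, C n →ₗ[K] C (n + 1))
    (hψ : ∀ (n : ℤ) (x : C (n + 1)), ψ n (dC n x) = dM n (ψ (n + 1) x))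
    (hφ : ∀ (n : ℤ) (x : M (n + 1)), φ n (dM n x) = dC n (φ (n + 1) x))
    (hψφ : ∀ (n : ℤ) (x : M n), ψ n (φ n x) = x)
    (hφψ : ∀ (n : ℤ) (x : C (n + 1)),
      φ (n + 1) (ψ (n + 1) x) = x - (γ n (dC n x) + dC (n + 1) (γ (n + 1) x)))
    (hγγ : ∀ (n : ℤ) (x : C n), γ (n + 1) (γ n x) = 0)
    (hγφ : ∀ (n : ℤ) (x : M n), γ n (φ n x) = 0)
    (hψγ : ∀ (n : ℤ) (x : C n), ψ (n + 1) (γ n x) = 0)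
    -- the second reduction (ψ', φ', γ') from M to M'
    (ψ' : ∀ n, M n →ₗ[K] M' n) (φ' : ∀ n, M' n →ₗ[K] M n)
    (γ' : ∀ n : ℤ, M n →ₗ[K] M (n + 1))
    (hψ' : ∀ (n : ℤ) (x : M (n + 1)), ψ' n (dM n x) = dM' n (ψ' (n + 1) x))
    (hφ' : ∀ (n : ℤ) (x : M' (n + 1)), φ' n (dM' n x) = dM n (φ' (n + 1) x))
    (hψφ' : ∀ (n : ℤ) (x : M' n), ψ' n (φ' n x) = x)
    (hφψ' : ∀ (n : ℤ) (x : M (n + 1)),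
      φ' (n + 1) (ψ' (n + 1) x) = x - (γ' n (dM n x) + dM (n + 1) (γ' (n + 1) x)))
    (hγγ' : ∀ (n : ℤ) (x : M n), γ' (n + 1) (γ' n x) = 0)
    (hγφ' : ∀ (n : ℤ) (x : M' n), γ' n (φ' n x) = 0)
    (hψγ' : ∀ (n : ℤ) (x : M n), ψ' (n + 1) (γ' n x) = 0) :
    -- γ'' is a splitting homotopy on (C, ∂)
    (∀ (n : ℤ) (x : C n),
      compHomotopy ψ φ γ γ' (n + 1) (compHomotopy ψ φ γ γ' n x) = 0) ∧
    (∀ (n : ℤ) (x : C n),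
      compHomotopy ψ φ γ γ' n (dC n (compHomotopy ψ φ γ γ' n x)) =
        compHomotopy ψ φ γ γ' n x) ∧
    -- if γ or γ' is perfect then γ'' is perfect
    (((∀ (n : ℤ) (x : C (n + 1)), dC n (γ n (dC n x)) = dC n x) ∨
        (∀ (n : ℤ) (x : M (n + 1)), dM n (γ' n (dM n x)) = dM n x)) →
      ∀ (n : ℤ) (x : C (n + 1)),
        dC n (compHomotopy ψ φ γ γ' n (dC n x)) = dC n x) := by
  have hγdγ : ∀ (n : ℤ) (x : C n), γ n (dC n (γ n x)) = γ n x := fun n x => by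
    have h := hφψ n (γ n x)
    rw [hψγ, hγγ, map_zero, map_zero, add_zero] at h
    exact (sub_eq_zero.mp h.symm).symm
  have hγdγ' : ∀ (n : ℤ) (x : M n), γ' n (dM n (γ' n x)) = γ' n x := fun n x => by
    have h := hφψ' n (γ' n x)
    rw [hψγ', hγγ', map_zero, map_zero, add_zero] at h
    exact (sub_eq_zero.mp h.symm).symm
  simp only [compHomotopy, LinearMap.add_apply, LinearMap.comp_apply, map_add]
  refine ⟨fun n x => ?_, fun n x => ?_, ?_⟩
  · simp [hγγ, hγφ, hψγ, hψφ, hγγ']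
  · simp [hγdγ, ← hφ, hγφ, hψ, hψγ, hψφ, hγdγ']
  · rintro (hperf | hperf) n x
    · have hdM : ∀ y : M (n + 1), dM n y = 0 := fun y => by
        rw [← hψφ n (dM n y), hφ, ← hperf, hψ, hψγ, map_zero]
      simp [hperf, hψ, hdM]
    · rw [← hφ, hψ, hperf, hφ, hφψ, map_sub, map_add, hddC, add_zero, add_sub_cancel]
end

section
/- Let K be a field, L a finite distributive lattice, V a K-vector space, and f : L → Submodule_K(V) a map satisfying f(⊥) = 0, f(⊤) = V, f(a ⊔ b) = f(a) + f(b), and f(a ⊓ b) = f(a) ∩ f(b) for all a, b ∈ L. Then there exists a family (W_q)_{q ∈ J(L)} of K-submodules of V indexed by the join-irreducible elements of L such that the family (W_q) is independent and, for every a ∈ L, f(a) = ⨆_{q ∈ J(L), q ≤ a} W_q; in particular V is the internal direct sum of the family (W_q)_{q ∈ J(L)}. -/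
theorem joinIrred_iff_supIrred {L : Type*} [Lattice L] [OrderBot L] {a : L} :
    JoinIrred a ↔ SupIrred a := by
  simp only [JoinIrred, SupIrred, isMin_iff_eq_bot, ne_eq, eq_comm (a := a)]

theorem monotone_of_map_sup {L M : Type*} [SemilatticeSup L] [SemilatticeSup M] {f : L → M}
    (hsup : ∀ a b, f (a ⊔ b) = f a ⊔ f b) : Monotone f := fun a b hab => by
  rw [← sup_eq_right.2 hab, hsup]
  exact le_sup_left

section Splitting

variable {L M : Type*} [DistribLattice L] [OrderBot L]

/-- Strictly below a join-irreducible element of a finite distributive lattice there is a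
largest element. -/
theorem SupIrred.exists_isGreatest_Iio [Fintype L] {q : L} (hq : SupIrred q) :
    ∃ p, IsGreatest (Set.Iio q) p := by
  classical
  refine ⟨(Finset.univ.filter (· < q)).sup id, ?_, fun r hr => ?_⟩
  · refine lt_of_le_of_ne (Finset.sup_le fun r hr => (Finset.mem_filter.1 hr).2.le) fun h => ?_
    obtain ⟨r, hr, rfl⟩ := hq.finset_sup_eq h
    exact (Finset.mem_filter.1 hr).2.ne rfl
  · exact Finset.le_sup (f := id) (Finset.mem_filter.2 ⟨Finset.mem_univ r, hr⟩)

variable [CompleteLattice M]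

/-- A join-preserving map is determined by pieces that, together with the values strictly below,
generate its values at the join-irreducible elements. -/
theorem eq_iSup_le_of_sup_eq [WellFoundedLT L] {f : L → M} (hbot : f ⊥ = ⊥)
    (hsup : ∀ a b, f (a ⊔ b) = f a ⊔ f b) {W : {q : L // SupIrred q} → M}
    (hW : ∀ q : {q : L // SupIrred q}, ∃ p < q.1, W q ⊔ f p = f q) (a : L) :
    f a = ⨆ q : {q : L // SupIrred q}, ⨆ _ : (q : L) ≤ a, W q := by
  have hmono := monotone_of_map_sup hsup
  have hle {b a : L} (hba : b ≤ a) :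
      (⨆ q : {q : L // SupIrred q}, ⨆ _ : (q : L) ≤ b, W q) ≤
        ⨆ q : {q : L // SupIrred q}, ⨆ _ : (q : L) ≤ a, W q :=
    iSup_mono fun q => iSup_mono' fun h => ⟨h.trans hba, le_rfl⟩
  apply le_antisymm
  · induction a using WellFoundedLT.induction with
    | ind a ih =>
      by_cases ha : SupIrred a
      · obtain ⟨p, hp, hWp⟩ := hW ⟨a, ha⟩
        rw [← hWp]
        exact sup_le (le_iSup₂_of_le ⟨a, ha⟩ le_rfl le_rfl) ((ih p hp).trans (hle hp.le))
      · obtain ha | ⟨b, c, rfl, hb, hc⟩ := not_supIrred.1 ha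
        · rw [ha.eq_bot, hbot]
          exact bot_le
        · rw [hsup]
          exact sup_le ((ih b hb).trans (hle hb.le)) ((ih c hc).trans (hle hc.le))
  · refine iSup₂_le fun q hq => ?_
    obtain ⟨p, -, hWp⟩ := hW q
    exact (le_sup_left.trans hWp.le).trans (hmono hq)

/-- Pieces of a lattice morphism at join-irreducible elements which are disjoint from all values
strictly below form an independent family. -/
theorem supIndep_of_disjoint_lt [IsModularLattice M] {f : L → M}
    (hsup : ∀ a b, f (a ⊔ b) = f a ⊔ f b) (hinf : ∀ a b, f (a ⊓ b) = f a ⊓ f b)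
    {W : {q : L // SupIrred q} → M} (hle : ∀ q, W q ≤ f q)
    (hW : ∀ q : {q : L // SupIrred q}, ∀ p < q.1, Disjoint (W q) (f p))
    (S : Finset {q : L // SupIrred q}) : S.SupIndep W := by
  classical
  have hmono := monotone_of_map_sup hsup
  induction S using Finset.strongInduction with
  | H S ih =>
    obtain rfl | hS := S.eq_empty_or_nonempty
    · exact Finset.supIndep_empty W
    obtain ⟨q, hq⟩ := S.exists_maximal hS
    rw [← Finset.insert_erase hq.prop]
    refine (ih _ (Finset.erase_ssubset hq.prop)).insert ?_
    set s : L := (S.erase q).sup Subtype.val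
    have hqs : ¬ q.1 ≤ s := fun h => by
      obtain ⟨r, hr, hqr⟩ := (supPrime_iff_supIrred.2 q.2).le_finset_sup.1 h
      exact Finset.ne_of_mem_erase hr (hq.eq_of_le (Finset.mem_of_mem_erase hr) hqr).symm
    have hs : (S.erase q).sup W ≤ f s :=
      Finset.sup_le fun r hr => (hle r).trans (hmono (Finset.le_sup (f := Subtype.val) hr))
    refine Disjoint.mono_right hs (disjoint_iff_inf_le.2 ?_)
    calc W q ⊓ f s ≤ W q ⊓ f (q ⊓ s) := by
          rw [hinf]
          exact le_inf inf_le_left (inf_le_inf_right _ (hle q))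
      _ ≤ ⊥ := (hW q _ (inf_lt_left.2 hqs)).le_bot

/-- A lattice morphism from a finite distributive lattice to a complemented modular lattice splits
into independent pieces indexed by the join-irreducible elements. -/
theorem exists_iSupIndep_eq_iSup_le [Fintype L] [IsModularLattice M] [ComplementedLattice M]
    {f : L → M}
    (hbot : f ⊥ = ⊥) (hsup : ∀ a b, f (a ⊔ b) = f a ⊔ f b)
    (hinf : ∀ a b, f (a ⊓ b) = f a ⊓ f b) :
    ∃ W : {q : L // SupIrred q} → M, iSupIndep W ∧
      ∀ a, f a = ⨆ q : {q : L // SupIrred q}, ⨆ _ : (q : L) ≤ a, W q := by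
  classical
  have hmono := monotone_of_map_sup hsup
  choose p hp using fun q : {q : L // SupIrred q} => q.2.exists_isGreatest_Iio
  choose c hc using fun q => exists_isCompl (f (p q))
  refine ⟨fun q => c q ⊓ f q, ?_, eq_iSup_le_of_sup_eq hbot hsup fun q => ⟨p q, (hp q).1, ?_⟩⟩
  · rw [iSupIndep_iff_supIndep_univ]
    refine supIndep_of_disjoint_lt hsup hinf (fun q => inf_le_right) (fun q r hr => ?_) _
    exact (hc q).disjoint.symm.mono inf_le_left (hmono ((hp q).2 hr))
  · rw [sup_comm, ← sup_inf_assoc_of_le _ (hmono (hp q).1.le), (hc q).sup_eq_top, top_inf_eq]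

end Splitting

/-- Every lattice morphism f from a finite distributive lattice L
to the subspace lattice of a K-vector space V splits: there is an independent
family (W_q), indexed by the join-irreducibles of L, with
f(a) = ⨆_{q ≤ a} W_q for every a; in particular V is the internal direct sum
of the W_q. -/
theorem stmt_13 {K : Type*} [Field K]
    {L : Type*} [DistribLattice L] [BoundedOrder L] [Fintype L]
    {V : Type*} [AddCommGroup V] [Module K V]
    (f : L → Submodule K V)
    (hbot : f ⊥ = ⊥) (htop : f ⊤ = ⊤)
    (hsup : ∀ a b : L, f (a ⊔ b) = f a ⊔ f b)
    (hinf : ∀ a b : L, f (a ⊓ b) = f a ⊓ f b) :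
    ∃ W : {q : L // JoinIrred q} → Submodule K V,
      (∀ q, W q ⊓ (⨆ r, ⨆ _ : r ≠ q, W r) = ⊥) ∧
      (∀ a : L, f a = ⨆ q : {q : L // JoinIrred q}, ⨆ _ : (q : L) ≤ a, W q) ∧
      (⨆ q, W q) = ⊤ := by
  have hJ : JoinIrred (L := L) = SupIrred := funext fun _ => propext joinIrred_iff_supIrred
  rw [hJ]
  obtain ⟨W, hind, hW⟩ := exists_iSupIndep_eq_iSup_le hbot hsup hinf
  refine ⟨W, fun q => (hind q).eq_bot, hW, ?_⟩
  rw [← htop, hW ⊤]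
  simp only [le_top, iSup_pos]
end

section
/- Let L be a finite distributive lattice, K a field, and (C, f) an L-filtered chain complex. Then (C, f) is strict — i.e., for every join-irreducible a ∈ L with predecessor ⟵a and every n, ∂_n(f_n(a)) ⊆ f_{n-1}(⟵a) — if and only if for all a, b ∈ L such that b covers a (a < b and there is no c with a < c < b) and all n, ∂_n(f_n(b)) ⊆ f_{n-1}(a). -/
/-- If `a ⋖ b` in a finite lattice, then `b` is the join of `a` and a join-irreducible
element `p` that covers `p ⊓ a`. -/
theorem exists_joinIrred_sup_eq_of_covBy {L : Type*} [Lattice L] [OrderBot L] [Finite L]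
    {a b : L} (hab : a ⋖ b) : ∃ p : L, JoinIrred p ∧ p ⊓ a ⋖ p ∧ a ⊔ p = b := by
  obtain ⟨p, ⟨hpb, hpa⟩, hmin⟩ :=
    wellFounded_lt.has_min {p : L | p ≤ b ∧ ¬ p ≤ a} ⟨b, le_rfl, hab.lt.not_ge⟩
  have below : ∀ q < p, q ≤ a := fun q hq => by
    by_contra hqa
    exact hmin q ⟨hq.le.trans hpb, hqa⟩ hq
  refine ⟨p, ⟨fun h => hpa (h ▸ bot_le), fun x y hxy => ?_⟩, ⟨inf_lt_left.2 hpa, ?_⟩, ?_⟩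
  · by_contra! h
    refine hpa (hxy.le.trans (sup_le (below x ?_) (below y ?_)))
    · exact lt_of_le_of_ne (le_sup_left.trans hxy.ge) h.1.symm
    · exact lt_of_le_of_ne (le_sup_right.trans hxy.ge) h.2.symm
  · exact fun q hq hqp => hq.not_ge (le_inf hqp.le (below q hqp))
  · exact (hab.eq_or_eq le_sup_left (sup_le hab.le hpb)).resolve_left
      fun h => hpa (sup_eq_left.1 h)

/-- An L-filtered chain complex is strict (the boundary maps the
filtration piece of each join-irreducible a into that of its predecessor,
i.e. of every element covered by a) iff whenever b covers a, the boundary maps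
the filtration piece of b into that of a. -/
theorem stmt_15 {K : Type*} [Field K]
    {L : Type*} [DistribLattice L] [BoundedOrder L] [Fintype L]
    {C : ℤ → Type*} [∀ n, AddCommGroup (C n)] [∀ n, Module K (C n)]
    (d : ∀ n : ℤ, C (n + 1) →ₗ[K] C n)
    (hdd : ∀ (n : ℤ) (x : C (n + 1 + 1)), d n (d (n + 1) x) = 0)
    (f : ∀ n : ℤ, L → Submodule K (C n))
    (hbot : ∀ n, f n ⊥ = ⊥) (htop : ∀ n, f n ⊤ = ⊤)
    (hsup : ∀ n (a b : L), f n (a ⊔ b) = f n a ⊔ f n b)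
    (hinf : ∀ n (a b : L), f n (a ⊓ b) = f n a ⊓ f n b)
    (hd : ∀ (n : ℤ) (a : L), Submodule.map (d n) (f (n + 1) a) ≤ f n a) :
    (∀ a : L, JoinIrred a → ∀ b : L, b ⋖ a →
        ∀ n : ℤ, Submodule.map (d n) (f (n + 1) a) ≤ f n b) ↔
      (∀ a b : L, a ⋖ b →
        ∀ n : ℤ, Submodule.map (d n) (f (n + 1) b) ≤ f n a) := by
  refine ⟨fun h a b hab n => ?_, fun h a _ b hba n => h b a hba n⟩
  obtain ⟨p, hp, hcov, rfl⟩ := exists_joinIrred_sup_eq_of_covBy hab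
  rw [hsup, Submodule.map_sup]
  refine sup_le (hd n a) ((h p hp _ hcov n).trans ?_)
  rw [hinf]
  exact inf_le_right
end

section
/- Let L be a finite distributive lattice, K a field, and let (C, f) and (C', f') be strict L-filtered chain complexes. If φ : (C, f) → (C', f') is an L-filtered chain equivalence, then each φ_n is a linear isomorphism and φ_n(f_n(a)) = f'_n(a) for all n ∈ ℤ and a ∈ L; in particular, strict L-filtered chain complexes are L-filtered chain homotopy equivalent if and only if they are L-filtered chain isomorphic. -/
/-- Induction on a finite lattice along joins: it suffices to treat `⊥`, joins of two
elements, and join-irreducible elements with a predecessor. -/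
theorem JoinIrred.induction {L : Type*} [Lattice L] [OrderBot L] [Finite L] {p : L → Prop}
    (bot : p ⊥) (sup : ∀ a b, p a → p b → p (a ⊔ b))
    (irred : ∀ a b, JoinIrred a → b ⋖ a → p b → p a) (a : L) : p a := by
  induction a using WellFoundedLT.induction with
  | ind a ih =>
    by_cases ha : a = ⊥
    · exact ha ▸ bot
    by_cases hirr : JoinIrred a
    · obtain ⟨b, -, hb⟩ := exists_le_covBy_of_lt (bot_lt_iff_ne_bot.mpr ha)
      exact irred a b hirr hb (ih b hb.lt)
    · simp only [JoinIrred, not_and, not_forall, not_or] at hirr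
      obtain ⟨b, c, hbc, hb, hc⟩ := hirr ha
      rw [hbc]
      exact sup b c (ih b (lt_of_le_of_ne (hbc ▸ le_sup_left) (Ne.symm hb)))
        (ih c (lt_of_le_of_ne (hbc ▸ le_sup_right) (Ne.symm hc)))

section StrictEndomorphism

variable {K L M : Type*} [Ring K] [Lattice L] [BoundedOrder L] [Finite L]
  [AddCommGroup M] [Module K M] {F : L → Submodule K M} {N : Module.End K M}

/-- An endomorphism that strictly lowers a lattice filtration on join-irreducibles is nilpotent. -/
theorem isNilpotent_of_map_le_of_covBy (hbot : F ⊥ = ⊥) (htop : F ⊤ = ⊤)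
    (hsup : ∀ a b, F (a ⊔ b) = F a ⊔ F b)
    (hN : ∀ a, JoinIrred a → ∀ b, b ⋖ a → (F a).map N ≤ F b) : IsNilpotent N := by
  have key : ∀ a, ∃ k : ℕ, F a ≤ LinearMap.ker (N ^ k) := by
    refine JoinIrred.induction ⟨0, hbot ▸ bot_le⟩ ?_ ?_
    · rintro a b ⟨k, hk⟩ ⟨l, hl⟩
      refine ⟨k + l, hsup a b ▸ sup_le (fun x hx => ?_) (fun x hx => ?_)⟩
      · rw [LinearMap.mem_ker, add_comm, pow_add, Module.End.mul_apply,
          LinearMap.mem_ker.mp (hk hx), map_zero]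
      · rw [LinearMap.mem_ker, pow_add, Module.End.mul_apply,
          LinearMap.mem_ker.mp (hl hx), map_zero]
    · rintro a b ha hba ⟨k, hk⟩
      refine ⟨k + 1, fun x hx => ?_⟩
      rw [LinearMap.mem_ker, pow_succ, Module.End.mul_apply]
      exact hk (hN a ha b hba (Submodule.mem_map_of_mem hx))
  obtain ⟨k, hk⟩ := key ⊤
  exact ⟨k, LinearMap.ext fun x => hk (htop ▸ Submodule.mem_top)⟩

/-- If `T - 1` strictly lowers a lattice filtration on join-irreducibles, then every piece of the
filtration is contained in its image under `T`. -/
theorem le_map_of_map_sub_one_le {T : Module.End K M} (hbot : F ⊥ = ⊥)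
    (hsup : ∀ a b, F (a ⊔ b) = F a ⊔ F b)
    (hT : ∀ a, JoinIrred a → ∀ b, b ⋖ a → (F a).map (T - 1) ≤ F b) (a : L) :
    F a ≤ (F a).map T := by
  refine JoinIrred.induction (p := fun a => F a ≤ (F a).map T) (hbot ▸ bot_le) ?_ ?_ a
  · intro a b ha hb
    rw [hsup, Submodule.map_sup]
    exact sup_le_sup ha hb
  · intro a b ha hba hb x hx
    have hmono : F b ≤ F a := by
      rw [← sup_eq_right.mpr hba.le, hsup]
      exact le_sup_left
    have hsub : (T - 1) x ∈ (F a).map T :=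
      Submodule.map_mono hmono (hb (hT a ha b hba (Submodule.mem_map_of_mem hx)))
    simpa using sub_mem (Submodule.mem_map_of_mem (f := T) hx) hsub

/-- If `T - 1` strictly lowers a lattice filtration on join-irreducibles, then `T` is injective. -/
theorem injective_of_map_sub_one_le {T : Module.End K M} (hbot : F ⊥ = ⊥) (htop : F ⊤ = ⊤)
    (hsup : ∀ a b, F (a ⊔ b) = F a ⊔ F b)
    (hT : ∀ a, JoinIrred a → ∀ b, b ⋖ a → (F a).map (T - 1) ≤ F b) :
    Function.Injective T := by
  have hunit : IsUnit T := by
    simpa using (isNilpotent_of_map_le_of_covBy hbot htop hsup hT).isUnit_add_one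
  exact ((Module.End.isUnit_iff T).mp hunit).injective

end StrictEndomorphism

/-- In a strict filtered complex, an endomorphism homotopic to the identity by a filtered homotopy
differs from it by a map that strictly lowers the filtration on join-irreducibles. -/
theorem map_sub_one_le_of_homotopy {K L C₀ C₁ C₂ : Type*} [Ring K] [Lattice L] [OrderBot L]
    [AddCommGroup C₀] [Module K C₀] [AddCommGroup C₁] [Module K C₁]
    [AddCommGroup C₂] [Module K C₂]
    {f₀ : L → Submodule K C₀} {f₁ : L → Submodule K C₁} {f₂ : L → Submodule K C₂}
    {d₀ : C₁ →ₗ[K] C₀} {d₁ : C₂ →ₗ[K] C₁} {γ₀ : C₀ →ₗ[K] C₁} {γ₁ : C₁ →ₗ[K] C₂}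
    {T : Module.End K C₁}
    (hd₀ : ∀ a, JoinIrred a → ∀ b, b ⋖ a → (f₁ a).map d₀ ≤ f₀ b)
    (hd₁ : ∀ a, JoinIrred a → ∀ b, b ⋖ a → (f₂ a).map d₁ ≤ f₁ b)
    (hγ₀ : ∀ a, (f₀ a).map γ₀ ≤ f₁ a) (hγ₁ : ∀ a, (f₁ a).map γ₁ ≤ f₂ a)
    (hT : ∀ x, T x - x = γ₀ (d₀ x) + d₁ (γ₁ x))
    (a : L) (ha : JoinIrred a) (b : L) (hba : b ⋖ a) : (f₁ a).map (T - 1) ≤ f₁ b := by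
  rintro _ ⟨x, hx, rfl⟩
  rw [LinearMap.sub_apply, Module.End.one_apply, hT]
  exact add_mem
    (hγ₀ b (Submodule.mem_map_of_mem (hd₀ a ha b hba (Submodule.mem_map_of_mem hx))))
    (hd₁ a ha b hba (Submodule.mem_map_of_mem (hγ₁ a (Submodule.mem_map_of_mem hx))))

/-- If φ is an L-filtered chain equivalence between strict
L-filtered chain complexes, then each φ_n is a linear isomorphism mapping the
filtration of (C, f) onto that of (C', f'); hence strict L-filtered chain
complexes are L-filtered chain homotopy equivalent iff they are L-filtered
chain isomorphic. -/
theorem stmt_16 {K : Type*} [Field K]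
    {L : Type*} [DistribLattice L] [BoundedOrder L] [Fintype L]
    {C C' : ℤ → Type*}
    [∀ n, AddCommGroup (C n)] [∀ n, Module K (C n)]
    [∀ n, AddCommGroup (C' n)] [∀ n, Module K (C' n)]
    (d : ∀ n : ℤ, C (n + 1) →ₗ[K] C n) (d' : ∀ n : ℤ, C' (n + 1) →ₗ[K] C' n)
    (hdd : ∀ (n : ℤ) (x : C (n + 1 + 1)), d n (d (n + 1) x) = 0)
    (hdd' : ∀ (n : ℤ) (x : C' (n + 1 + 1)), d' n (d' (n + 1) x) = 0)
    (f : ∀ n : ℤ, L → Submodule K (C n)) (f' : ∀ n : ℤ, L → Submodule K (C' n))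
    -- f and f' are L-filterings
    (hbot : ∀ n, f n ⊥ = ⊥) (htop : ∀ n, f n ⊤ = ⊤)
    (hsup : ∀ n (a b : L), f n (a ⊔ b) = f n a ⊔ f n b)
    (hinf : ∀ n (a b : L), f n (a ⊓ b) = f n a ⊓ f n b)
    (hd : ∀ (n : ℤ) (a : L), Submodule.map (d n) (f (n + 1) a) ≤ f n a)
    (hbot' : ∀ n, f' n ⊥ = ⊥) (htop' : ∀ n, f' n ⊤ = ⊤)
    (hsup' : ∀ n (a b : L), f' n (a ⊔ b) = f' n a ⊔ f' n b)
    (hinf' : ∀ n (a b : L), f' n (a ⊓ b) = f' n a ⊓ f' n b)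
    (hd' : ∀ (n : ℤ) (a : L), Submodule.map (d' n) (f' (n + 1) a) ≤ f' n a)
    -- both complexes are strict: the boundary of the piece of a
    -- join-irreducible lands in the piece of its predecessor
    (hstrict : ∀ a : L, JoinIrred a → ∀ b : L, b ⋖ a →
      ∀ n : ℤ, Submodule.map (d n) (f (n + 1) a) ≤ f n b)
    (hstrict' : ∀ a : L, JoinIrred a → ∀ b : L, b ⋖ a →
      ∀ n : ℤ, Submodule.map (d' n) (f' (n + 1) a) ≤ f' n b)
    -- φ is an L-filtered chain equivalence with homotopy inverse ψ
    (φ : ∀ n, C n →ₗ[K] C' n) (ψ : ∀ n, C' n →ₗ[K] C n)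
    (hφf : ∀ (n : ℤ) (a : L), Submodule.map (φ n) (f n a) ≤ f' n a)
    (hψf : ∀ (n : ℤ) (a : L), Submodule.map (ψ n) (f' n a) ≤ f n a)
    (hφc : ∀ (n : ℤ) (x : C (n + 1)), φ n (d n x) = d' n (φ (n + 1) x))
    (hψc : ∀ (n : ℤ) (x : C' (n + 1)), ψ n (d' n x) = d n (ψ (n + 1) x))
    (γ : ∀ n : ℤ, C n →ₗ[K] C (n + 1)) (γ' : ∀ n : ℤ, C' n →ₗ[K] C' (n + 1))
    (hγf : ∀ (n : ℤ) (a : L), Submodule.map (γ n) (f n a) ≤ f (n + 1) a)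
    (hγ'f : ∀ (n : ℤ) (a : L), Submodule.map (γ' n) (f' n a) ≤ f' (n + 1) a)
    (hγ : ∀ (n : ℤ) (x : C (n + 1)),
      ψ (n + 1) (φ (n + 1) x) - x = γ n (d n x) + d (n + 1) (γ (n + 1) x))
    (hγ' : ∀ (n : ℤ) (x : C' (n + 1)),
      φ (n + 1) (ψ (n + 1) x) - x = γ' n (d' n x) + d' (n + 1) (γ' (n + 1) x)) :
    (∀ n, Function.Bijective (φ n)) ∧
      ∀ (n : ℤ) (a : L), Submodule.map (φ n) (f n a) = f' n a := by
  have hinj : ∀ n, Function.Injective (φ n) := by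
    intro m
    obtain ⟨n, rfl⟩ : ∃ n, m = n + 1 := ⟨m - 1, by ring⟩
    have hT := map_sub_one_le_of_homotopy (T := ψ (n + 1) ∘ₗ φ (n + 1))
      (fun a ha b hba => hstrict a ha b hba n) (fun a ha b hba => hstrict a ha b hba (n + 1))
      (hγf n) (hγf (n + 1)) (hγ n)
    exact Function.Injective.of_comp (f := ψ (n + 1))
      (injective_of_map_sub_one_le (hbot _) (htop _) (hsup _) hT)
  have hmap : ∀ (n : ℤ) (a : L), Submodule.map (φ n) (f n a) = f' n a := by
    intro m a
    obtain ⟨n, rfl⟩ : ∃ n, m = n + 1 := ⟨m - 1, by ring⟩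
    have hT := map_sub_one_le_of_homotopy (T := φ (n + 1) ∘ₗ ψ (n + 1))
      (fun a ha b hba => hstrict' a ha b hba n) (fun a ha b hba => hstrict' a ha b hba (n + 1))
      (hγ'f n) (hγ'f (n + 1)) (hγ' n)
    refine le_antisymm (hφf _ a) ((le_map_of_map_sub_one_le (hbot' _) (hsup' _) hT a).trans ?_)
    rw [Submodule.map_comp]
    exact Submodule.map_mono (hψf _ a)
  refine ⟨fun n => ⟨hinj n, ?_⟩, hmap⟩
  rw [← LinearMap.range_eq_top, LinearMap.range_eq_map, ← htop n, hmap, htop']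
end
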